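/- arXiv:2001.08488 — 7 statements merged into one kernel-verified Lean document; each statement's English description precedes it below -/
import Mathlib

section
/- Let φ : ℝ → ℝ be differentiable on [0,∞) with continuous derivative there, and suppose φ(r) > 0 for all r ≥ 0. Assume there exist constants ρ > 0 and A > 0 such that φ'(r) + A·φ(r)^{1+ρ} ≤ 0 for all r > 0. Then φ(r) ≤ (1/(ρ·A·r))^{1/ρ} for all r > 0. -/
/-- Lemma 3.4: If `φ` is positive and `C¹` on `[0,∞)` and satisfies the
differential inequality `φ'(r) + A φ(r)^{1+ρ} ≤ 0` for all `r > 0`, with `ρ, A > 0`,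
then `φ(r) ≤ (1/(ρ A r))^{1/ρ}` for all `r > 0`. -/
theorem decay_from_differential_inequality
    (φ : ℝ → ℝ)
    (hdiff : ∀ r ∈ Set.Ici (0 : ℝ), DifferentiableAt ℝ φ r)
    (hcont : ContinuousOn (deriv φ) (Set.Ici (0 : ℝ)))
    (hpos : ∀ r : ℝ, 0 ≤ r → 0 < φ r)
    (ρ A : ℝ) (hρ : 0 < ρ) (hA : 0 < A)
    (hineq : ∀ r : ℝ, 0 < r → deriv φ r + A * φ r ^ (1 + ρ) ≤ 0) :
    ∀ r : ℝ, 0 < r → φ r ≤ (1 / (ρ * A * r)) ^ (1 / ρ) := by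
  intro r hr
  have hderiv : ∀ x : ℝ, 0 ≤ x →
      HasDerivAt (fun t => φ t ^ (-ρ)) (deriv φ x * (-ρ) * φ x ^ (-ρ - 1)) x := fun x hx =>
    (hdiff x hx).hasDerivAt.rpow_const (Or.inl (hpos x hx).ne')
  have hslope : ∀ x ∈ interior (Set.Ici (0 : ℝ)), ρ * A ≤ deriv (fun t => φ t ^ (-ρ)) x := by
    intro x hx
    rw [interior_Ici, Set.mem_Ioi] at hx
    rw [(hderiv x hx.le).deriv]
    have hφ := hpos x hx.le
    have hcancel : φ x ^ (1 + ρ) * φ x ^ (-ρ - 1) = 1 := by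
      rw [← Real.rpow_add hφ, show 1 + ρ + (-ρ - 1) = 0 by ring, Real.rpow_zero]
    have hprod := mul_nonpos_of_nonpos_of_nonneg (hineq x hx)
      (mul_pos hρ (Real.rpow_pos_of_pos hφ (-ρ - 1))).le
    linear_combination hprod - A * ρ * hcancel
  have hgrowth := (convex_Ici (0 : ℝ)).mul_sub_le_image_sub_of_le_deriv
    (fun x hx => (hderiv x hx).continuousAt.continuousWithinAt)
    (fun x hx => (hderiv x (interior_subset hx)).differentiableAt.differentiableWithinAt)
    hslope 0 Set.self_mem_Ici r hr.le hr.le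
  have hφ := hpos r hr.le
  have hlower : ρ * A * r ≤ (φ r ^ ρ)⁻¹ := by
    rw [← Real.rpow_neg hφ.le]
    linarith [Real.rpow_pos_of_pos (hpos 0 le_rfl) (-ρ)]
  have hupper : φ r ^ ρ ≤ 1 / (ρ * A * r) := by
    rw [one_div]
    exact (le_inv_comm₀ (by positivity) (by positivity)).mp hlower
  rw [one_div ρ]
  exact (Real.le_rpow_inv_iff_of_pos hφ.le (by positivity) hρ).mpr hupper
end

section
/- Let N ≥ 1 be a natural number and let p, q be real numbers with 1 < p < q < 1 + 4/N. Set α := N(p−1)/2 and β := N(q−1)/2, and define γ_N(p) := (16 + N² + 6N − pN(N+2)) / (N(N+2−(N−2)p)). Suppose G, P, Q are positive real numbers satisfying the two Pohozaev-type identities G + P − Q = 0 and G + αP/(p+1) − βQ/(q+1) = 0. Then G + α(α−1)P/(p+1) − β(β−1)Q/(q+1) < 0 if and only if γ_N(p) < q. -/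
/-- Lemma 5.5, algebraic core: with `α = N(p-1)/2`, `β = N(q-1)/2` and
positive `G, P, Q` satisfying the two Pohozaev-type identities, the quantity
`G + α(α-1)P/(p+1) - β(β-1)Q/(q+1)` is negative iff `γ_N(p) < q`. -/
theorem instability_condition_iff
    (N : ℕ) (hN : 1 ≤ N) (p q : ℝ) (hp : 1 < p) (hpq : p < q) (hq : q < 1 + 4 / N)
    (G P Q : ℝ) (hG : 0 < G) (hP : 0 < P) (hQ : 0 < Q)
    (hNehari : G + P - Q = 0)
    (hPoho : G + (N * (p - 1) / 2) * P / (p + 1) - (N * (q - 1) / 2) * Q / (q + 1) = 0) :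
    G + (N * (p - 1) / 2) * ((N * (p - 1) / 2) - 1) * P / (p + 1)
        - (N * (q - 1) / 2) * ((N * (q - 1) / 2) - 1) * Q / (q + 1) < 0
      ↔ (16 + (N : ℝ) ^ 2 + 6 * N - p * N * (N + 2)) / (N * (N + 2 - (N - 2) * p)) < q := by
  have hn : (1 : ℝ) ≤ N := by exact_mod_cast hN
  set n : ℝ := (N : ℝ)
  have hnq : n * (q - 1) < 4 := by
    have h := mul_lt_mul_of_pos_left (sub_left_lt_of_lt_add hq) (by linarith : 0 < n)
    rwa [mul_div_cancel₀ _ (by linarith : n ≠ 0)] at h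
  have hnp : n * (p - 1) < 4 := by nlinarith
  have hA : 0 < n + 2 - (n - 2) * p := by nlinarith
  have hG' : G = Q - P := by linarith
  subst hG'
  have hp1 : p + 1 ≠ 0 := by linarith
  have hq1 : q + 1 ≠ 0 := by linarith
  -- Eliminating `P` via the two identities factors the second derivative.
  have key : (4 * (q + 1) * (n + 2 - (n - 2) * p)) *
      (Q - P + (n * (p - 1) / 2) * ((n * (p - 1) / 2) - 1) * P / (p + 1)
        - (n * (q - 1) / 2) * ((n * (q - 1) / 2) - 1) * Q / (q + 1)) =
      (Q * n * (q - p)) * (16 + n ^ 2 + 6 * n - p * n * (n + 2)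
        - q * (n * (n + 2 - (n - 2) * p))) := by
    have hPoho' : P * (n + 2 - (n - 2) * p) * (q + 1)
        = Q * (n + 2 - (n - 2) * q) * (p + 1) := by
      field_simp at hPoho
      linarith
    field_simp
    linear_combination (-4 * (4 * (p + 1) - n ^ 2 * (p - 1) ^ 2 + 2 * n * (p - 1))) * hPoho'
  have hL : 0 < 4 * (q + 1) * (n + 2 - (n - 2) * p) := mul_pos (by linarith) hA
  have hR : 0 < Q * n * (q - p) :=
    mul_pos (mul_pos hQ (by linarith)) (sub_pos.mpr hpq)
  rw [div_lt_iff₀ (mul_pos (by linarith) hA), ← sub_neg (b := q * _),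
    ← smul_neg_iff_of_pos_left hL, smul_eq_mul, key, ← smul_eq_mul,
    smul_neg_iff_of_pos_left hR]
end

section
/- Let N ≥ 1 be a natural number, define γ_N(p) := (16 + N² + 6N − pN(N+2)) / (N(N+2−(N−2)p)), and set p_N := (N + √(2N) + 4) / (√N(√N + √2)). Then 1 < p_N < 1 + 4/N, γ_N(p_N) = p_N, and p_N is the unique fixed point of γ_N in the interval of real p with 1 < p and (N ≤ 2 or p < (N+2)/(N−2)): for every such p, γ_N(p) = p holds if and only if p = p_N. -/
/-- The candidate fixed point written as `1 + 4 / (√x (√x + √2))`. -/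
theorem fixedPoint_eq_one_add {x : ℝ} (hx : 0 < x) :
    (x + Real.sqrt (2 * x) + 4) / (Real.sqrt x * (Real.sqrt x + Real.sqrt 2))
      = 1 + 4 / (Real.sqrt x * (Real.sqrt x + Real.sqrt 2)) := by
  have hs : 0 < Real.sqrt x := Real.sqrt_pos.2 hx
  have hss : Real.sqrt x ^ 2 = x := Real.sq_sqrt hx.le
  have ht : 0 < Real.sqrt 2 := Real.sqrt_pos.2 two_pos
  rw [Real.sqrt_mul zero_le_two]
  field_simp
  linear_combination -hss

/-- Where the denominator is positive, the only fixed point above `1` is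
`1 + 4 / (√x (√x + √2))`. -/
theorem gamma_eq_self_iff {x p : ℝ} (hx : 0 < x) (hp : 1 < p) (hD : 0 < x + 2 - (x - 2) * p) :
    (16 + x ^ 2 + 6 * x - p * x * (x + 2)) / (x * (x + 2 - (x - 2) * p)) = p ↔
      p = 1 + 4 / (Real.sqrt x * (Real.sqrt x + Real.sqrt 2)) := by
  have hs : 0 < Real.sqrt x := Real.sqrt_pos.2 hx
  have hss : Real.sqrt x ^ 2 = x := Real.sq_sqrt hx.le
  have ht : 0 < Real.sqrt 2 := Real.sqrt_pos.2 two_pos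
  have htt : Real.sqrt 2 ^ 2 = 2 := Real.sq_sqrt zero_le_two
  generalize Real.sqrt x = s at *
  generalize Real.sqrt 2 = t at *
  subst hss
  have hq : 0 < p - 1 := sub_pos.2 hp
  have hother : 0 < 4 - s * (s - t) * (p - 1) := by
    rcases le_total s t with h | h
    · have := mul_nonneg (mul_nonneg hs.le (sub_nonneg.2 h)) hq.le
      linarith
    · have h1 := mul_nonneg (mul_nonneg ht.le (sub_nonneg.2 h)) hq.le
      have h2 : 0 < 4 - (s + t) * (s - t) * (p - 1) := by
        convert hD using 1
        linear_combination (p - 1) * htt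
      linarith
  have hfactor : 16 + (s ^ 2) ^ 2 + 6 * s ^ 2 - p * s ^ 2 * (s ^ 2 + 2)
      - p * (s ^ 2 * (s ^ 2 + 2 - (s ^ 2 - 2) * p))
      = (4 - s * (s + t) * (p - 1)) * (4 - s * (s - t) * (p - 1)) := by
    linear_combination (s ^ 2 * (p - 1) ^ 2) * htt
  rw [div_eq_iff (by positivity), ← sub_eq_zero, hfactor, mul_eq_zero_iff_right hother.ne',
    ← sub_eq_iff_eq_add', eq_div_iff (by positivity)]
  constructor <;> intro h <;> linarith

/-- Remark 1.13, fixed point: with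
`p_N = (N + √(2N) + 4)/(√N(√N + √2))`, one has `1 < p_N < 1 + 4/N`, `γ_N(p_N) = p_N`,
and `p_N` is the unique fixed point of `γ_N` on the interval `1 < p`
(with `p < (N+2)/(N-2)` when `N ≥ 3`). -/
theorem gammaN_fixed_point (N : ℕ) (hN : 1 ≤ N) :
    (1 < ((N : ℝ) + Real.sqrt (2 * N) + 4) / (Real.sqrt N * (Real.sqrt N + Real.sqrt 2))) ∧
    (((N : ℝ) + Real.sqrt (2 * N) + 4) / (Real.sqrt N * (Real.sqrt N + Real.sqrt 2))
        < 1 + 4 / N) ∧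
    ((16 + (N : ℝ) ^ 2 + 6 * N
        - (((N : ℝ) + Real.sqrt (2 * N) + 4) / (Real.sqrt N * (Real.sqrt N + Real.sqrt 2)))
          * N * (N + 2))
      / (N * ((N : ℝ) + 2 - (N - 2) *
        (((N : ℝ) + Real.sqrt (2 * N) + 4) / (Real.sqrt N * (Real.sqrt N + Real.sqrt 2)))))
      = ((N : ℝ) + Real.sqrt (2 * N) + 4) / (Real.sqrt N * (Real.sqrt N + Real.sqrt 2))) ∧
    (∀ p : ℝ, 1 < p → ((N : ℕ) ≤ 2 ∨ p < ((N : ℝ) + 2) / ((N : ℝ) - 2)) →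
      ((16 + (N : ℝ) ^ 2 + 6 * N - p * N * (N + 2)) / (N * (N + 2 - (N - 2) * p)) = p
        ↔ p = ((N : ℝ) + Real.sqrt (2 * N) + 4)
                / (Real.sqrt N * (Real.sqrt N + Real.sqrt 2)))) := by
  have hn : (1 : ℝ) ≤ N := by exact_mod_cast hN
  have hx : (0 : ℝ) < N := by linarith
  rw [fixedPoint_eq_one_add hx]
  have hs : 0 < Real.sqrt N := Real.sqrt_pos.2 hx
  have hss : Real.sqrt N ^ 2 = N := Real.sq_sqrt hx.le
  have ht : 0 < Real.sqrt 2 := Real.sqrt_pos.2 two_pos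
  have htt : Real.sqrt 2 ^ 2 = 2 := Real.sq_sqrt zero_le_two
  have hone : 1 < 1 + 4 / (Real.sqrt N * (Real.sqrt N + Real.sqrt 2)) :=
    lt_add_of_pos_right _ (by positivity)
  refine ⟨hone, ?_, (gamma_eq_self_iff hx hone ?_).2 rfl, fun p hp hlt =>
    gamma_eq_self_iff hx hp ?_⟩
  · gcongr
    linarith [mul_pos hs ht]
  · have hden : (N : ℝ) + 2 - (N - 2) * (1 + 4 / (Real.sqrt N * (Real.sqrt N + Real.sqrt 2)))
        = 4 * Real.sqrt 2 / Real.sqrt N := by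
      field_simp
      linear_combination 4 * hss - 4 * htt
    rw [hden]
    positivity
  · rcases le_or_gt N 2 with h | h
    · have h2 : (N : ℝ) ≤ 2 := by exact_mod_cast h
      have := mul_nonneg (sub_nonneg.2 h2) (zero_le_one.trans hp.le)
      linarith
    · have h2 : (2 : ℝ) < N := by exact_mod_cast h
      have := (lt_div_iff₀ (sub_pos.2 h2)).1 (hlt.resolve_left h.not_ge)
      linarith
end

section
/- Let N ≥ 1 be a natural number and let p, q be real numbers with 1 < p < q and q ≥ 1 + 4/N. Set α := N(p−1)/2 and β := N(q−1)/2 (so 0 < α < β and β ≥ 2). Let ω ≥ 0 and let A > 0, B ≥ 0, C > 0, D > 0 be real numbers; in the case q = 1 + 4/N (i.e. β = 2) assume in addition that A + αC/(p+1) − βD/(q+1) ≤ 0. Then there exists λ₀ > 0 such that λ₀²A + ωB + λ₀^α C − λ₀^β D = 0. -/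
open Filter Topology in
/-- A combination `λ^γ A + E + λ^α C - λ^β D` of real powers with a dominant negative term
vanishes at some positive `λ`. -/
lemma exists_pos_rpow_combination_eq_zero {α β γ A C D E : ℝ} (hβ : 0 < β) (hαβ : α < β)
    (hA : 0 ≤ A) (hC : 0 < C) (hD : 0 < D) (hE : 0 ≤ E) (h : γ < β ∨ γ = β ∧ A < D) :
    ∃ x : ℝ, 0 < x ∧ x ^ γ * A + E + x ^ α * C - x ^ β * D = 0 := by
  obtain ⟨L, hLD, hL⟩ : ∃ L < D, Tendsto (fun x : ℝ => x ^ (γ - β) * A) atTop (𝓝 L) := by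
    rcases h with h | ⟨rfl, h⟩
    · refine ⟨0, hD, ?_⟩
      simpa using (tendsto_rpow_neg_atTop (sub_pos.2 h)).mul_const A
    · exact ⟨A, h, by simp⟩
  let g : ℝ → ℝ := fun x => x ^ (γ - β) * A + x ^ (-β) * E + x ^ (α - β) * C - D
  have hg : Tendsto g atTop (𝓝 (L - D)) := by
    have h₁ := (tendsto_rpow_neg_atTop hβ).mul_const E
    have h₂ := (tendsto_rpow_neg_atTop (sub_pos.2 hαβ)).mul_const C
    simpa [g] using ((hL.add h₁).add h₂).sub_const D
  obtain ⟨b, hgb, hb⟩ : ∃ b, g b < 0 ∧ 0 < b :=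
    ((hg.eventually_lt_const (sub_neg.2 hLD)).and (eventually_gt_atTop 0)).exists
  have hcont : ContinuousOn g (Set.Ioi 0) := by
    have hpow (r : ℝ) : ContinuousOn (fun x : ℝ => x ^ r) (Set.Ioi 0) := fun x hx =>
      (Real.continuousAt_rpow_const x r (.inl (ne_of_gt hx))).continuousWithinAt
    exact ((((hpow _).mul continuousOn_const).add ((hpow _).mul continuousOn_const)).add
      ((hpow _).mul continuousOn_const)).sub continuousOn_const
  have ha : 0 < (D / C) ^ (α - β)⁻¹ := by positivity
  have hga : 0 ≤ g ((D / C) ^ (α - β)⁻¹) := by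
    have : ((D / C) ^ (α - β)⁻¹) ^ (α - β) * C = D := by
      rw [Real.rpow_inv_rpow (by positivity) (sub_ne_zero.2 hαβ.ne), div_mul_cancel₀ _ hC.ne']
    simp only [g, this, add_sub_cancel_right]
    positivity
  obtain ⟨x, hx, hgx⟩ := isPreconnected_Ioi.intermediate_value hb ha hcont ⟨hgb.le, hga⟩
  have hx : 0 < x := hx
  refine ⟨x, hx, ?_⟩
  have hmul : x ^ β * g x = x ^ γ * A + E + x ^ α * C - x ^ β * D := by
    have := (Real.rpow_pos_of_pos hx β).ne'
    simp only [g, Real.rpow_sub hx, Real.rpow_neg hx.le]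
    field_simp
  rw [← hmul, hgx, mul_zero]

/-- Lemma 4.2, scaling form: with `α = N(p-1)/2`, `β = N(q-1)/2`,
`1 < p < q`, `q ≥ 1 + 4/N`, `ω ≥ 0` and coefficients `A > 0`, `B ≥ 0`, `C > 0`, `D > 0`
(assuming additionally `A + αC/(p+1) - βD/(q+1) ≤ 0` when `q = 1 + 4/N`),
there exists `λ₀ > 0` with `λ₀²A + ωB + λ₀^α C - λ₀^β D = 0`. -/
theorem exists_nehari_zero_of_scaling
    (N : ℕ) (hN : 1 ≤ N) (p q : ℝ) (hp : 1 < p) (hpq : p < q) (hq : 1 + 4 / N ≤ q)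
    (ω : ℝ) (hω : 0 ≤ ω)
    (A B C D : ℝ) (hA : 0 < A) (hB : 0 ≤ B) (hC : 0 < C) (hD : 0 < D)
    (hcrit : q = 1 + 4 / N →
      A + (N * (p - 1) / 2) * C / (p + 1) - (N * (q - 1) / 2) * D / (q + 1) ≤ 0) :
    ∃ lam : ℝ, 0 < lam ∧
      lam ^ 2 * A + ω * B + lam ^ (N * (p - 1) / 2) * C - lam ^ (N * (q - 1) / 2) * D = 0 := by
  have hN₀ : (0 : ℝ) < N := by exact_mod_cast hN
  have hαβ : N * (p - 1) / 2 < N * (q - 1) / 2 := by gcongr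
  have hcase : (2 : ℝ) < N * (q - 1) / 2 ∨ (2 : ℝ) = N * (q - 1) / 2 ∧ A < D := by
    rcases hq.lt_or_eq with h | h
    · left
      have : 4 / (N : ℝ) < q - 1 := by linarith
      rw [div_lt_iff₀ hN₀] at this
      linarith
    · right
      have hβ : N * (q - 1) / 2 = 2 := by
        rw [← h]
        field_simp
        ring
      have hP := hcrit h.symm
      rw [hβ] at hP
      have hαC : 0 < N * (p - 1) / 2 * C / (p + 1) := by
        have := sub_pos.2 hp
        positivity
      have hDq : 2 * D / (q + 1) < D := by
        rw [div_lt_iff₀ (by linarith)]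
        nlinarith
      exact ⟨hβ.symm, by linarith⟩
  have hβ : (0 : ℝ) < N * (q - 1) / 2 := by
    rcases hcase with h | ⟨h, -⟩ <;> linarith
  simpa only [Real.rpow_two] using
    exists_pos_rpow_combination_eq_zero hβ hαβ hA.le hC hD (mul_nonneg hω hB) hcase
end

section
/- Let α, β be real numbers with 0 < α < β and 2 ≤ β, let G > 0, C ≥ 0, D ≥ 0, E ∈ ℝ, and define f : (0,∞) → ℝ by f(λ) := E + (G/2)λ² + Cλ^α − Dλ^β. If f'(1) = 0, then f(λ) ≤ f(1) for all λ > 0; that is, f attains its maximum over (0,∞) at λ = 1. -/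
/-- For fixed `x > 0`, the quotient `(x ^ a - 1) / a` is monotone in `a > 0`. -/
theorem rpow_sub_one_div_le_rpow_sub_one_div {x a b : ℝ} (hx : 0 < x) (ha : 0 < a) (hab : a ≤ b) :
    (x ^ a - 1) / a ≤ (x ^ b - 1) / b := by
  have hb : 0 < b := ha.trans_le hab
  have hpos : 0 < x ^ a := Real.rpow_pos_of_pos hx a
  have bernoulli : 1 + b / a * (x ^ a - 1) ≤ (1 + (x ^ a - 1)) ^ (b / a) :=
    one_add_mul_self_le_rpow_one_add (by linarith) ((one_le_div ha).2 hab)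
  rw [add_sub_cancel, ← Real.rpow_mul hx.le, mul_div_cancel₀ b ha.ne'] at bernoulli
  rw [le_div_iff₀ hb]
  calc (x ^ a - 1) / a * b = b / a * (x ^ a - 1) := by ring
    _ ≤ x ^ b - 1 := by linarith

/-- Lemma 4.3, core calculus fact: for `0 < α < β`, `2 ≤ β`,
`G > 0`, `C ≥ 0`, `D ≥ 0`, the function `f(λ) = E + (G/2)λ² + Cλ^α - Dλ^β`
with `f'(1) = 0` attains its maximum over `(0,∞)` at `λ = 1`. -/
theorem max_at_one_of_deriv_zero
    (α β : ℝ) (hα : 0 < α) (hαβ : α < β) (hβ : 2 ≤ β)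
    (G C D E : ℝ) (hG : 0 < G) (hC : 0 ≤ C) (hD : 0 ≤ D)
    (hderiv : deriv (fun lam : ℝ => E + G / 2 * lam ^ 2 + C * lam ^ α - D * lam ^ β) 1 = 0) :
    ∀ lam : ℝ, 0 < lam →
      E + G / 2 * lam ^ 2 + C * lam ^ α - D * lam ^ β
        ≤ E + G / 2 * 1 ^ 2 + C * (1 : ℝ) ^ α - D * (1 : ℝ) ^ β := by
  have hasDeriv : HasDerivAt
      (fun lam : ℝ => E + G / 2 * lam ^ 2 + C * lam ^ α - D * lam ^ β)
      (G + C * α - D * β) 1 := by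
    have hsq : HasDerivAt (fun lam : ℝ => lam ^ 2) 2 1 := by
      simpa using hasDerivAt_pow 2 (1 : ℝ)
    have hrpow (a : ℝ) : HasDerivAt (fun lam : ℝ => lam ^ a) a 1 := by
      simpa using Real.hasDerivAt_rpow_const (x := 1) (p := a) (Or.inl one_ne_zero)
    refine ((((hsq.const_mul (G / 2)).const_add E).add ((hrpow α).const_mul C)).sub
      ((hrpow β).const_mul D)).congr_deriv ?_
    ring
  have balance : G + C * α - D * β = 0 := hasDeriv.deriv.symm.trans hderiv
  intro lam hlam
  have hβ_pos : 0 < β := hα.trans hαβ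
  have quadratic := mul_le_mul_of_nonneg_left
    (rpow_sub_one_div_le_rpow_sub_one_div hlam two_pos hβ) hG.le
  have power := mul_le_mul_of_nonneg_left
    (rpow_sub_one_div_le_rpow_sub_one_div hlam hα hαβ.le) (mul_nonneg hC hα.le)
  rw [Real.rpow_two] at quadratic
  have hα_cancel : C * α * ((lam ^ α - 1) / α) = C * (lam ^ α - 1) := by
    field_simp
  have hβ_cancel : (G + C * α) * ((lam ^ β - 1) / β) = D * (lam ^ β - 1) := by
    rw [sub_eq_zero.1 balance]
    field_simp
  simp only [Real.one_rpow]
  linarith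
end

section
/- Let N ≥ 1 be a natural number, let p, q, ω be real numbers with 1 < p < q and ω ≥ 0, and let r₀ > 0. Let φ : (0,∞) → ℝ be twice differentiable and satisfy the radial ODE −φ''(r) − ((N−1)/r)φ'(r) + ωφ(r) + φ(r)^p − φ(r)^q = 0 for all r ≥ r₀. Assume φ(r) > 0 and φ'(r) < 0 for all r ≥ r₀, that φ(r) → 0 and φ'(r) → 0 as r → ∞, and that φ(r)^q ≤ (1/2)φ(r)^p for all r ≥ r₀. Then φ'(r)² ≥ φ(r)^{p+1}/(p+1) for all r ≥ r₀, hence φ'(r) + (p+1)^{−1/2}·φ(r)^{(p+1)/2} ≤ 0 for all r ≥ r₀; consequently φ(r₀ + r) ≤ (2√(p+1)/((p−1)r))^{2/(p−1)} for all r > 0. -/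
open Filter

/-- Energy estimate: if a positive decreasing `φ` on `[a,∞)` vanishes at infinity together with
its derivative and `φ'' ≥ φ^p / 2`, then `φ'^2 ≥ φ^(p+1) / (p+1)`. -/
theorem rpow_div_le_sq_deriv {p a : ℝ} (hp : 0 < p + 1) {φ : ℝ → ℝ}
    (hdiff : ∀ r, a ≤ r → DifferentiableAt ℝ φ r)
    (hdiff' : ∀ r, a ≤ r → DifferentiableAt ℝ (deriv φ) r)
    (hconv : ∀ r, a ≤ r → 1 / 2 * φ r ^ p ≤ deriv (deriv φ) r)
    (hpos : ∀ r, a ≤ r → 0 < φ r) (hdec : ∀ r, a ≤ r → deriv φ r ≤ 0)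
    (hlim : Tendsto φ atTop (nhds 0)) (hlim' : Tendsto (deriv φ) atTop (nhds 0))
    {r : ℝ} (hr : a ≤ r) : φ r ^ (p + 1) / (p + 1) ≤ deriv φ r ^ 2 := by
  set E : ℝ → ℝ := fun x => deriv φ x ^ 2 - φ x ^ (p + 1) / (p + 1) with hE
  have hderiv : ∀ x, a ≤ x →
      HasDerivAt E (2 * deriv φ x * (deriv (deriv φ) x - 1 / 2 * φ x ^ p)) x := by
    intro x hx
    have h1 := (hdiff' x hx).hasDerivAt.pow 2
    have h2 := ((hdiff x hx).hasDerivAt.rpow_const (p := p + 1)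
      (Or.inl (hpos x hx).ne')).div_const (p + 1)
    refine (h1.sub h2).congr_deriv ?_
    rw [add_sub_cancel_right]
    field_simp
    ring
  have hanti : AntitoneOn E (Set.Ici a) := by
    refine antitoneOn_of_deriv_nonpos (convex_Ici a)
      (fun x hx => (hderiv x hx).continuousAt.continuousWithinAt) ?_ ?_
    · intro x hx
      exact (hderiv x (interior_subset hx)).differentiableAt.differentiableWithinAt
    · intro x hx
      have hx' : a ≤ x := interior_subset hx
      rw [(hderiv x hx').deriv]
      have h1 := hdec x hx'
      have h2 := hconv x hx'
      exact mul_nonpos_of_nonpos_of_nonneg (by linarith) (by linarith)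
  have hElim : Tendsto E atTop (nhds 0) := by
    have h := (hlim'.pow 2).sub ((hlim.rpow_const (p := p + 1) (Or.inr hp.le)).div_const (p + 1))
    simpa [Real.zero_rpow hp.ne'] using h
  have hnonneg : 0 ≤ E r := by
    refine le_of_tendsto hElim ?_
    filter_upwards [eventually_ge_atTop r] with x hx
    exact hanti hr (hr.trans hx) hx
  simp only [hE] at hnonneg
  linarith

/-- A positive solution of `φ' + c φ^(s+1) ≤ 0` on `[a,∞)`, with `c, s > 0`, is bounded by
`(1 / (c s r))^(1/s)` at `a + r`, whatever its initial value. -/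
theorem le_rpow_of_deriv_add_rpow_nonpos {a c s : ℝ} (hc : 0 < c) (hs : 0 < s) {φ : ℝ → ℝ}
    (hdiff : ∀ r, a ≤ r → DifferentiableAt ℝ φ r) (hpos : ∀ r, a ≤ r → 0 < φ r)
    (hineq : ∀ r, a ≤ r → deriv φ r + c * φ r ^ (s + 1) ≤ 0) {r : ℝ} (hr : 0 < r) :
    φ (a + r) ≤ (1 / (c * s * r)) ^ (1 / s) := by
  have hderiv : ∀ x, a ≤ x →
      HasDerivAt (fun y => φ y ^ (-s)) (deriv φ x * (-s) * φ x ^ (-s - 1)) x := fun x hx =>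
    (hdiff x hx).hasDerivAt.rpow_const (Or.inl (hpos x hx).ne')
  have hgrow : c * s * (a + r - a) ≤ φ (a + r) ^ (-s) - φ a ^ (-s) := by
    refine (convex_Ici a).mul_sub_le_image_sub_of_le_deriv (f := fun y => φ y ^ (-s))
      (fun x hx => (hderiv x hx).continuousAt.continuousWithinAt)
      (fun x hx => (hderiv x (interior_subset hx)).differentiableAt.differentiableWithinAt) ?_
      a Set.self_mem_Ici (a + r) (Set.mem_Ici.2 (by linarith)) (by linarith)
    intro x hx
    have hx' : a ≤ x := interior_subset hx
    rw [(hderiv x hx').deriv]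
    have hcancel : φ x ^ (s + 1) * φ x ^ (-s - 1) = 1 := by
      rw [← Real.rpow_add (hpos x hx'), show s + 1 + (-s - 1) = 0 by ring, Real.rpow_zero]
    have hmul := mul_nonneg (mul_nonneg hs.le (Real.rpow_pos_of_pos (hpos x hx') (-s - 1)).le)
      (neg_nonneg.2 (hineq x hx'))
    linear_combination hmul - c * s * hcancel
  have ha : 0 < φ (a + r) := hpos _ (by linarith)
  have hlow : c * s * r ≤ (φ (a + r) ^ s)⁻¹ := by
    rw [← Real.rpow_neg ha.le]
    have := Real.rpow_pos_of_pos (hpos a le_rfl) (-s)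
    linarith
  have hup : φ (a + r) ^ s ≤ 1 / (c * s * r) := by
    rw [one_div]
    exact le_inv_of_le_inv₀ (by positivity) hlow
  calc φ (a + r) = (φ (a + r) ^ s) ^ (1 / s) := by
        rw [one_div, Real.rpow_rpow_inv ha.le hs.ne']
    _ ≤ _ := Real.rpow_le_rpow (by positivity) hup (by positivity)

/-- core of Proposition 3.5: a positive decreasing solution of the radial
ODE `-φ'' - ((N-1)/r)φ' + ωφ + φ^p - φ^q = 0` on `[r₀,∞)` with `φ, φ' → 0` at infinity
and `φ^q ≤ φ^p/2` there satisfies `φ'(r)² ≥ φ(r)^{p+1}/(p+1)`, hence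
`φ'(r) + (p+1)^{-1/2} φ(r)^{(p+1)/2} ≤ 0`, and consequently the algebraic decay
`φ(r₀+r) ≤ (2√(p+1)/((p-1)r))^{2/(p-1)}`. -/
theorem radial_ode_algebraic_decay
    (N : ℕ) (hN : 1 ≤ N) (p q ω : ℝ) (hp : 1 < p) (hpq : p < q) (hω : 0 ≤ ω)
    (r₀ : ℝ) (hr₀ : 0 < r₀) (φ : ℝ → ℝ)
    (hdiff : ∀ r : ℝ, r₀ ≤ r → DifferentiableAt ℝ φ r)
    (hdiff' : ∀ r : ℝ, r₀ ≤ r → DifferentiableAt ℝ (deriv φ) r)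
    (hODE : ∀ r : ℝ, r₀ ≤ r →
      -(deriv (deriv φ) r) - ((N : ℝ) - 1) / r * deriv φ r
        + ω * φ r + φ r ^ p - φ r ^ q = 0)
    (hpos : ∀ r : ℝ, r₀ ≤ r → 0 < φ r)
    (hdec : ∀ r : ℝ, r₀ ≤ r → deriv φ r < 0)
    (hlim : Tendsto φ atTop (nhds 0))
    (hlim' : Tendsto (deriv φ) atTop (nhds 0))
    (hsmall : ∀ r : ℝ, r₀ ≤ r → φ r ^ q ≤ 1 / 2 * φ r ^ p) :
    (∀ r : ℝ, r₀ ≤ r → φ r ^ (p + 1) / (p + 1) ≤ (deriv φ r) ^ 2) ∧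
    (∀ r : ℝ, r₀ ≤ r → deriv φ r + (p + 1) ^ (-(1 / 2 : ℝ)) * φ r ^ ((p + 1) / 2) ≤ 0) ∧
    (∀ r : ℝ, 0 < r →
      φ (r₀ + r) ≤ (2 * Real.sqrt (p + 1) / ((p - 1) * r)) ^ (2 / (p - 1))) := by
  have hp1 : 0 < p + 1 := by linarith
  have hconv : ∀ r, r₀ ≤ r → 1 / 2 * φ r ^ p ≤ deriv (deriv φ) r := by
    intro r hr
    have hN' : (0 : ℝ) ≤ (N : ℝ) - 1 := sub_nonneg.2 (by exact_mod_cast hN)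
    have hdamp : ((N : ℝ) - 1) / r * deriv φ r ≤ 0 :=
      mul_nonpos_of_nonneg_of_nonpos (div_nonneg hN' (hr₀.le.trans hr)) (hdec r hr).le
    have hmass : 0 ≤ ω * φ r := mul_nonneg hω (hpos r hr).le
    linarith [hODE r hr, hsmall r hr]
  have henergy : ∀ r : ℝ, r₀ ≤ r → φ r ^ (p + 1) / (p + 1) ≤ (deriv φ r) ^ 2 := fun r hr =>
    rpow_div_le_sq_deriv hp1 hdiff hdiff' hconv hpos (fun x hx => (hdec x hx).le) hlim hlim' hr
  have hfirst : ∀ r : ℝ, r₀ ≤ r →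
      deriv φ r + (p + 1) ^ (-(1 / 2 : ℝ)) * φ r ^ ((p + 1) / 2) ≤ 0 := by
    intro r hr
    have hsq : ((p + 1) ^ (-(1 / 2 : ℝ)) * φ r ^ ((p + 1) / 2)) ^ 2 = φ r ^ (p + 1) / (p + 1) := by
      rw [mul_pow, ← Real.rpow_mul_natCast hp1.le, ← Real.rpow_mul_natCast (hpos r hr).le,
        show -(1 / 2 : ℝ) * (2 : ℕ) = -1 by norm_num,
        show (p + 1) / 2 * (2 : ℕ) = p + 1 by push_cast; ring, Real.rpow_neg_one]
      ring
    have hle := henergy r hr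
    rw [← hsq, ← neg_sq (deriv φ r)] at hle
    have := le_of_abs_le (abs_le_of_sq_le_sq hle (neg_nonneg.2 (hdec r hr).le))
    linarith
  refine ⟨henergy, hfirst, fun r hr => ?_⟩
  have hs : 0 < (p - 1) / 2 := by linarith
  have hdecay := le_rpow_of_deriv_add_rpow_nonpos (Real.rpow_pos_of_pos hp1 (-(1 / 2 : ℝ))) hs
    hdiff hpos (fun x hx => by
      rw [show (p - 1) / 2 + 1 = (p + 1) / 2 by ring]
      exact hfirst x hx) hr
  have hp1' : 0 < p - 1 := by linarith
  have hsqrt : 0 < Real.sqrt (p + 1) := Real.sqrt_pos.2 hp1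
  rw [Real.rpow_neg hp1.le, ← Real.sqrt_eq_rpow] at hdecay
  convert hdecay using 2 <;> field_simp
end

section
/- Let N ≥ 3 be a natural number, set p* := N/(N−2) and κ := ((N−2)/√2)^{N−2}, and define S : (1,∞) → ℝ by S(r) := κ·r^{−(N−2)}·(log r)^{−(N−2)/2}. Then for every r > 1, S''(r) + ((N−1)/r)·S'(r) = S(r)^{p*} + (N/(2(N−2)))·S(r)^{p*}/log r. In particular S is positive on (1,∞) and satisfies ΔS = S^{p*} + (N/(2(N−2)))·S^{p*}/log r as a radial function. -/
open Real in
/-- The derivative of `x ^ α * (log x) ^ β` on `(1, ∞)`. -/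
theorem hasDerivAt_rpow_mul_log_rpow (α β : ℝ) {r : ℝ} (hr : 1 < r) :
    HasDerivAt (fun x : ℝ => x ^ α * log x ^ β)
      (α * (r ^ (α - 1) * log r ^ β) + β * (r ^ (α - 1) * log r ^ (β - 1))) r := by
  have hr0 : 0 < r := by linarith
  have hlog : 0 < log r := log_pos hr
  have h := (hasDerivAt_rpow_const (p := α) (Or.inl hr0.ne')).mul
    ((hasDerivAt_log hr0.ne').rpow_const (p := β) (Or.inl hlog.ne'))
  refine h.congr_deriv ?_
  rw [rpow_sub_one hr0.ne' α]
  field_simp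

open Real in
/-- The radial Laplacian in dimension `a + 2` of `c * x ^ (-a) * (log x) ^ (-b)`: the terms in
`(log r) ^ (-b)` cancel because `x ^ (-a)` is harmonic. -/
theorem radial_laplacian_rpow_mul_log_rpow (c a b : ℝ) {r : ℝ} (hr : 1 < r) :
    deriv (deriv fun x : ℝ => c * x ^ (-a) * log x ^ (-b)) r
        + (a + 1) / r * deriv (fun x : ℝ => c * x ^ (-a) * log x ^ (-b)) r
      = c * r ^ (-(a + 2)) * (a * b * log r ^ (-(b + 1)) + b * (b + 1) * log r ^ (-(b + 2))) := by
  have hr0 : 0 < r := by linarith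
  have hderiv : ∀ x : ℝ, 1 < x → deriv (fun x : ℝ => c * x ^ (-a) * log x ^ (-b)) x
      = c * (-a * (x ^ (-a - 1) * log x ^ (-b)) + -b * (x ^ (-a - 1) * log x ^ (-b - 1))) := by
    intro x hx
    simp only [mul_assoc c]
    exact ((hasDerivAt_rpow_mul_log_rpow (-a) (-b) hx).const_mul c).deriv
  have hderiv₂ := ((((hasDerivAt_rpow_mul_log_rpow (-a - 1) (-b) hr).const_mul (-a)).add
    ((hasDerivAt_rpow_mul_log_rpow (-a - 1) (-b - 1) hr).const_mul (-b))).const_mul c).deriv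
  have heq := Filter.eventuallyEq_of_mem (Ioi_mem_nhds hr) hderiv
  rw [heq.deriv_eq, hderiv r hr]
  refine (congrArg (· + _) hderiv₂).trans ?_
  rw [show -(a + 2) = -a - 1 - 1 by ring, show -(b + 1) = -b - 1 by ring,
    show -(b + 2) = -b - 1 - 1 by ring, rpow_sub_one hr0.ne' (-a - 1)]
  field_simp
  ring

open Real in
/-- The power `(a + 2) / a` of the profile, for the normalisation `κ = (a / √2) ^ a`. -/
theorem log_profile_rpow {a r : ℝ} (ha : 0 < a) (hr : 1 < r) :
    ((a / √2) ^ a * r ^ (-a) * log r ^ (-(a / 2))) ^ ((a + 2) / a)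
      = (a / √2) ^ a * (a ^ 2 / 2) * r ^ (-(a + 2)) * log r ^ (-(a / 2 + 1)) := by
  have hr0 : 0 < r := by linarith
  have hlog : 0 < log r := log_pos hr
  have hκ : 0 < a / √2 := by positivity
  rw [mul_rpow (by positivity) (by positivity), mul_rpow (by positivity) (by positivity),
    ← rpow_mul hκ.le, ← rpow_mul hr0.le, ← rpow_mul hlog.le,
    show a * ((a + 2) / a) = a + 2 by field_simp,
    show -a * ((a + 2) / a) = -(a + 2) by field_simp,
    show -(a / 2) * ((a + 2) / a) = -(a / 2 + 1) by field_simp,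
    rpow_add hκ, rpow_two, div_pow, sq_sqrt (by norm_num : (0 : ℝ) ≤ 2)]

/-- equation (3.11): with `p* = N/(N-2)`, `κ = ((N-2)/√2)^{N-2}` and
`S(r) = κ r^{-(N-2)} (log r)^{-(N-2)/2}`, one has, for every `r > 1`,
`S'' + ((N-1)/r)S' = S^{p*} + (N/(2(N-2))) S^{p*}/log r`, and `S(r) > 0`. -/
theorem radial_log_supersolution_identity (N : ℕ) (hN : 3 ≤ N) :
    ∀ r : ℝ, 1 < r →
      (0 < (((N : ℝ) - 2) / Real.sqrt 2) ^ ((N : ℝ) - 2)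
              * r ^ (-((N : ℝ) - 2)) * Real.log r ^ (-(((N : ℝ) - 2) / 2))) ∧
      deriv (deriv (fun r : ℝ =>
          (((N : ℝ) - 2) / Real.sqrt 2) ^ ((N : ℝ) - 2)
            * r ^ (-((N : ℝ) - 2)) * Real.log r ^ (-(((N : ℝ) - 2) / 2)))) r
        + ((N : ℝ) - 1) / r
          * deriv (fun r : ℝ =>
              (((N : ℝ) - 2) / Real.sqrt 2) ^ ((N : ℝ) - 2)
                * r ^ (-((N : ℝ) - 2)) * Real.log r ^ (-(((N : ℝ) - 2) / 2))) r
        = ((((N : ℝ) - 2) / Real.sqrt 2) ^ ((N : ℝ) - 2)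
              * r ^ (-((N : ℝ) - 2)) * Real.log r ^ (-(((N : ℝ) - 2) / 2)))
            ^ ((N : ℝ) / ((N : ℝ) - 2))
          + (N : ℝ) / (2 * ((N : ℝ) - 2))
            * ((((N : ℝ) - 2) / Real.sqrt 2) ^ ((N : ℝ) - 2)
                * r ^ (-((N : ℝ) - 2)) * Real.log r ^ (-(((N : ℝ) - 2) / 2)))
              ^ ((N : ℝ) / ((N : ℝ) - 2)) / Real.log r := by
  intro r hr
  have hr0 : 0 < r := by linarith
  have hlog : 0 < Real.log r := Real.log_pos hr
  have hN' : (3 : ℝ) ≤ N := by exact_mod_cast hN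
  obtain ⟨a, ha⟩ : ∃ a : ℝ, (N : ℝ) - 2 = a := ⟨_, rfl⟩
  have ha0 : 0 < a := by linarith
  rw [ha, show (N : ℝ) - 1 = a + 1 by linarith, show (N : ℝ) = a + 2 by linarith]
  refine ⟨by positivity, ?_⟩
  rw [radial_laplacian_rpow_mul_log_rpow _ _ _ hr, log_profile_rpow ha0 hr,
    show -(a / 2 + 2) = -(a / 2 + 1) - 1 by ring, Real.rpow_sub_one hlog.ne']
  field_simp
end
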